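/- arXiv:2107.13849 — 8 statements merged into one kernel-verified Lean document; each statement's English description precedes it below -/
import Mathlib

section
/- Let u1, u2 : ℝ × ℝ → ℂ be smooth. Then u1, u2 solve the coupled NLS equation if and only if for every λ ∈ ℂ and every (x,t) ∈ ℝ × ℝ the zero-curvature equation holds entrywise: ∂t U(x,t,λ) − ∂x V(x,t,λ) + U(x,t,λ)·V(x,t,λ) − V(x,t,λ)·U(x,t,λ) = 0 (where ∂t and ∂x act entrywise on the matrices). -/
open Complex MeasureTheory Filter Topology ComplexConjugate Matrix

noncomputable section

/-- Partial derivative in the first (space) variable. -/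
def pdx (f : ℝ × ℝ → ℂ) (p : ℝ × ℝ) : ℂ := deriv (fun x => f (x, p.2)) p.1

/-- Partial derivative in the second (time) variable. -/
def pdt (f : ℝ × ℝ → ℂ) (p : ℝ × ℝ) : ℂ := deriv (fun t => f (p.1, t)) p.2

/-- Squared modulus, as a complex number. -/
def nsq (z : ℂ) : ℂ := (Complex.normSq z : ℂ)

/-- The coupled NLS (Manakov) equation at a point. -/
def CNLSat (u1 u2 : ℝ × ℝ → ℂ) (p : ℝ × ℝ) : Prop :=
  Complex.I * pdt u1 p + pdx (pdx u1) p + 2 * (nsq (u1 p) + nsq (u2 p)) * u1 p = 0 ∧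
  Complex.I * pdt u2 p + pdx (pdx u2) p + 2 * (nsq (u1 p) + nsq (u2 p)) * u2 p = 0

/-- The Lax matrix U. -/
def Umat (u1 u2 : ℝ × ℝ → ℂ) (l : ℂ) (p : ℝ × ℝ) : Matrix (Fin 3) (Fin 3) ℂ :=
  !![-2*I*l, u1 p, u2 p;
     -conj (u1 p), I*l, 0;
     -conj (u2 p), 0, I*l]

/-- The Lax matrix V. -/
def Vmat (u1 u2 : ℝ × ℝ → ℂ) (l : ℂ) (p : ℝ × ℝ) : Matrix (Fin 3) (Fin 3) ℂ :=
  !![-6*I*l^2 + I*(nsq (u1 p) + nsq (u2 p)), 3*l*u1 p + I * pdx u1 p, 3*l*u2 p + I * pdx u2 p;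
     -3*l*conj (u1 p) + I * pdx (fun q => conj (u1 q)) p, 3*I*l^2 - I*nsq (u1 p), -I*conj (u1 p)*u2 p;
     -3*l*conj (u2 p) + I * pdx (fun q => conj (u2 q)) p, -I*u1 p*conj (u2 p), 3*I*l^2 - I*nsq (u2 p)]

/-- The space-part Riccati equations at a point. -/
def SpaceRiccatiAt (u1 u2 : ℝ × ℝ → ℂ) (l : ℂ) (G1 G2 : ℝ × ℝ → ℂ) (p : ℝ × ℝ) : Prop :=
  pdx G1 p = 3*I*l*G1 p - u1 p*(G1 p)^2 - u2 p*G1 p*G2 p - conj (u1 p) ∧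
  pdx G2 p = 3*I*l*G2 p - u2 p*(G2 p)^2 - u1 p*G1 p*G2 p - conj (u2 p)

/-- The time-part Riccati equations at a point. -/
def TimeRiccatiAt (u1 u2 : ℝ × ℝ → ℂ) (l : ℂ) (G1 G2 : ℝ × ℝ → ℂ) (p : ℝ × ℝ) : Prop :=
  pdt G1 p = Vmat u1 u2 l p 1 0 + (Vmat u1 u2 l p 1 1 - Vmat u1 u2 l p 0 0) * G1 p
      + Vmat u1 u2 l p 1 2 * G2 p - Vmat u1 u2 l p 0 1 * (G1 p)^2
      - Vmat u1 u2 l p 0 2 * G1 p * G2 p ∧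
  pdt G2 p = Vmat u1 u2 l p 2 0 + (Vmat u1 u2 l p 2 2 - Vmat u1 u2 l p 0 0) * G2 p
      + Vmat u1 u2 l p 2 1 * G1 p - Vmat u1 u2 l p 0 1 * G1 p * G2 p
      - Vmat u1 u2 l p 0 2 * (G2 p)^2

/-- The frozen Bäcklund matrix B⁰ built from field values and Ω. -/
def frozenB0 (a b : ℝ) (u1 u2 tu1 tu2 : ℂ) (Om : ℝ) : Matrix (Fin 3) (Fin 3) ℂ :=
  !![(a:ℂ) + I/3*(Om:ℂ), I/3*(tu1-u1), I/3*(tu2-u2);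
     -conj (I/3*(tu1-u1)), (a:ℂ) - I*b - nsq (I/3*(tu1-u1))/(I/3*(Om:ℂ) + I*b),
       (-conj (I/3*(tu1-u1))) * (I/3*(tu2-u2)) / (I/3*(Om:ℂ) + I*b);
     -conj (I/3*(tu2-u2)),
       -conj ((-conj (I/3*(tu1-u1))) * (I/3*(tu2-u2)) / (I/3*(Om:ℂ) + I*b)),
       (a:ℂ) - I*b - nsq (I/3*(tu2-u2))/(I/3*(Om:ℂ) + I*b)]

/-- The space part of the Bäcklund transformation at a point. -/
def BTspaceAt (a : ℝ) (u1 u2 tu1 tu2 : ℝ × ℝ → ℂ) (B : Matrix (Fin 3) (Fin 3) ℂ)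
    (Om : ℝ) (p : ℝ × ℝ) : Prop :=
  pdx (fun q => u1 q - tu1 q) p
      = tu1 p * ((Om : ℂ) - 3*I*a) + 3*I*u1 p * B 1 1 + 3*I*u2 p * B 2 1 ∧
  pdx (fun q => u2 q - tu2 q) p
      = tu2 p * ((Om : ℂ) - 3*I*a) + 3*I*u1 p * B 1 2 + 3*I*u2 p * B 2 2

/-- The time part of the Bäcklund transformation at a point. -/
def BTtimeAt (a : ℝ) (u1 u2 tu1 tu2 : ℝ × ℝ → ℂ) (B : Matrix (Fin 3) (Fin 3) ℂ)
    (Om : ℝ) (p : ℝ × ℝ) : Prop :=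
  pdt (fun q => u1 q - tu1 q) p
      = I*(u1 p - tu1 p)*(nsq (u1 p) + nsq (u2 p) + nsq (tu1 p) + nsq (tu2 p))
        + I*(tu1 p*u2 p - u1 p*tu2 p)*conj (tu2 p)
        + I*pdx tu1 p*((Om:ℂ) - 3*I*a) - 3*pdx u1 p*B 1 1 - 3*pdx u2 p*B 2 1 ∧
  pdt (fun q => u2 q - tu2 q) p
      = I*(u2 p - tu2 p)*(nsq (u1 p) + nsq (u2 p) + nsq (tu1 p) + nsq (tu2 p))
        + I*(u1 p*tu2 p - tu1 p*u2 p)*conj (tu1 p)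
        + I*pdx tu2 p*((Om:ℂ) - 3*I*a) - 3*pdx u1 p*B 1 2 - 3*pdx u2 p*B 2 2

/-- The boundary V-matrix built from boundary data p_j (values) and q_j (x-derivatives). -/
def V0mat (p1 p2 q1 q2 : ℝ → ℂ) (t : ℝ) (mu : ℂ) : Matrix (Fin 3) (Fin 3) ℂ :=
  !![-6*I*mu^2 + I*(nsq (p1 t) + nsq (p2 t)), 3*mu*p1 t + I*q1 t, 3*mu*p2 t + I*q2 t;
     -3*mu*conj (p1 t) + I*conj (q1 t), 3*I*mu^2 - I*nsq (p1 t), -I*conj (p1 t)*p2 t;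
     -3*mu*conj (p2 t) + I*conj (q2 t), -I*p1 t*conj (p2 t), 3*I*mu^2 - I*nsq (p2 t)]

lemma nsq_eq (z : ℂ) : nsq z = z * conj z := (Complex.mul_conj z).symm

lemma hasDerivAt_conj {f : ℝ → ℂ} {f' : ℂ} {x : ℝ} (h : HasDerivAt f f' x) :
    HasDerivAt (fun y => conj (f y)) (conj f') x := by
  simpa using h.star

lemma slice_x {u : ℝ × ℝ → ℂ} (h : ContDiff ℝ (⊤ : ℕ∞) u) (t : ℝ) :
    ContDiff ℝ (⊤ : ℕ∞) (fun x => u (x, t)) :=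
  h.comp (contDiff_id.prodMk contDiff_const)

lemma slice_t {u : ℝ × ℝ → ℂ} (h : ContDiff ℝ (⊤ : ℕ∞) u) (x : ℝ) :
    ContDiff ℝ (⊤ : ℕ∞) (fun t => u (x, t)) :=
  h.comp (contDiff_const.prodMk contDiff_id)

lemma hx {u : ℝ × ℝ → ℂ} (h : ContDiff ℝ (⊤ : ℕ∞) u) (x t : ℝ) :
    HasDerivAt (fun y => u (y, t)) (pdx u (x, t)) x :=
  (((slice_x h t).differentiable (by simp)) x).hasDerivAt

lemma ht {u : ℝ × ℝ → ℂ} (h : ContDiff ℝ (⊤ : ℕ∞) u) (x t : ℝ) :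
    HasDerivAt (fun s => u (x, s)) (pdt u (x, t)) t :=
  (((slice_t h x).differentiable (by simp)) t).hasDerivAt

lemma hxx {u : ℝ × ℝ → ℂ} (h : ContDiff ℝ (⊤ : ℕ∞) u) (x t : ℝ) :
    HasDerivAt (fun y => pdx u (y, t)) (pdx (pdx u) (x, t)) x := by
  have h3 : ContDiff ℝ (⊤ : ℕ∞) (deriv (fun y => u (y, t))) :=
    (contDiff_infty_iff_deriv.mp (slice_x h t)).2
  exact ((h3.differentiable (by simp)) x).hasDerivAt

lemma pdx_conj {u : ℝ × ℝ → ℂ} (h : ContDiff ℝ (⊤ : ℕ∞) u) (p : ℝ × ℝ) :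
    pdx (fun q => conj (u q)) p = conj (pdx u p) :=
  (hasDerivAt_conj (hx h p.1 p.2)).deriv

lemma pdt_neg_conj {u : ℝ × ℝ → ℂ} (h : ContDiff ℝ (⊤ : ℕ∞) u) (p : ℝ × ℝ) :
    pdt (fun q => -conj (u q)) p = -conj (pdt u p) :=
  (hasDerivAt_conj (ht h p.1 p.2)).neg.deriv

lemma pdt_const (c : ℂ) (p : ℝ × ℝ) : pdt (fun _ => c) p = 0 := by simp [pdt]

lemma pdx_V00 {u v : ℝ × ℝ → ℂ} (h : ContDiff ℝ (⊤ : ℕ∞) u) (k : ContDiff ℝ (⊤ : ℕ∞) v)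
    (c : ℂ) (p : ℝ × ℝ) :
    pdx (fun q => c + I * (u q * conj (u q) + v q * conj (v q))) p
      = I * ((pdx u p * conj (u p) + u p * conj (pdx u p))
        + (pdx v p * conj (v p) + v p * conj (pdx v p))) :=
  (((((hx h p.1 p.2).mul (hasDerivAt_conj (hx h p.1 p.2))).add
    ((hx k p.1 p.2).mul (hasDerivAt_conj (hx k p.1 p.2)))).const_mul I).const_add c).deriv

lemma pdx_V01 {u : ℝ × ℝ → ℂ} (h : ContDiff ℝ (⊤ : ℕ∞) u) (c : ℂ) (p : ℝ × ℝ) :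
    pdx (fun q => c * u q + I * pdx u q) p = c * pdx u p + I * pdx (pdx u) p :=
  (((hx h p.1 p.2).const_mul c).add ((hxx h p.1 p.2).const_mul I)).deriv

lemma pdx_V10 {u : ℝ × ℝ → ℂ} (h : ContDiff ℝ (⊤ : ℕ∞) u) (c : ℂ) (p : ℝ × ℝ) :
    pdx (fun q => c * conj (u q) + I * conj (pdx u q)) p
      = c * conj (pdx u p) + I * conj (pdx (pdx u) p) :=
  (((hasDerivAt_conj (hx h p.1 p.2)).const_mul c).add
    ((hasDerivAt_conj (hxx h p.1 p.2)).const_mul I)).deriv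

lemma pdx_V11 {u : ℝ × ℝ → ℂ} (h : ContDiff ℝ (⊤ : ℕ∞) u) (c : ℂ) (p : ℝ × ℝ) :
    pdx (fun q => c - I * (u q * conj (u q))) p
      = -(I * (pdx u p * conj (u p) + u p * conj (pdx u p))) :=
  ((((hx h p.1 p.2).mul (hasDerivAt_conj (hx h p.1 p.2))).const_mul I).const_sub c).deriv

lemma pdx_V12 {u v : ℝ × ℝ → ℂ} (h : ContDiff ℝ (⊤ : ℕ∞) u) (k : ContDiff ℝ (⊤ : ℕ∞) v)
    (c : ℂ) (p : ℝ × ℝ) :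
    pdx (fun q => c * conj (u q) * v q) p
      = c * conj (pdx u p) * v p + c * conj (u p) * pdx v p :=
  (((hasDerivAt_conj (hx h p.1 p.2)).const_mul c).mul (hx k p.1 p.2)).deriv

lemma pdx_V21 {u v : ℝ × ℝ → ℂ} (h : ContDiff ℝ (⊤ : ℕ∞) u) (k : ContDiff ℝ (⊤ : ℕ∞) v)
    (c : ℂ) (p : ℝ × ℝ) :
    pdx (fun q => c * u q * conj (v q)) p
      = c * pdx u p * conj (v p) + c * u p * conj (pdx v p) :=
  (((hx h p.1 p.2).const_mul c).mul (hasDerivAt_conj (hx k p.1 p.2))).deriv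

/-- The left side of the zero-curvature equation, computed. -/
lemma curvature_eq (u1 u2 : ℝ × ℝ → ℂ) (h1 : ContDiff ℝ (⊤ : ℕ∞) u1)
    (h2 : ContDiff ℝ (⊤ : ℕ∞) u2) (l : ℂ) (p : ℝ × ℝ) :
    (Matrix.of fun i j => pdt (fun q => Umat u1 u2 l q i j) p)
          - (Matrix.of fun i j => pdx (fun q => Vmat u1 u2 l q i j) p)
          + Umat u1 u2 l p * Vmat u1 u2 l p - Vmat u1 u2 l p * Umat u1 u2 l p =
    !![0, -I * (I * pdt u1 p + pdx (pdx u1) p + 2 * (nsq (u1 p) + nsq (u2 p)) * u1 p),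
          -I * (I * pdt u2 p + pdx (pdx u2) p + 2 * (nsq (u1 p) + nsq (u2 p)) * u2 p);
       -I * conj (I * pdt u1 p + pdx (pdx u1) p + 2 * (nsq (u1 p) + nsq (u2 p)) * u1 p), 0, 0;
       -I * conj (I * pdt u2 p + pdx (pdx u2) p + 2 * (nsq (u1 p) + nsq (u2 p)) * u2 p), 0, 0] := by
  have hI : I ^ 2 = -1 := Complex.I_sq
  ext i j
  simp only [Matrix.sub_apply, Matrix.add_apply, Matrix.of_apply, Matrix.mul_apply,
    Fin.sum_univ_three]
  fin_cases i <;> fin_cases j <;>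
    simp only [Umat, Vmat, Fin.zero_eta, Fin.mk_one, Fin.reduceFinMk, Matrix.of_apply,
      Matrix.cons_val, pdx_conj h1, pdx_conj h2, nsq_eq, pdt_const,
      pdt_neg_conj h1, pdt_neg_conj h2, pdx_V00 h1 h2, pdx_V01 h1, pdx_V01 h2, pdx_V10 h1,
      pdx_V10 h2, pdx_V11 h1, pdx_V11 h2, pdx_V12 h1 h2, pdx_V21 h1 h2, map_add, map_mul,
      Complex.conj_conj, Complex.conj_I, map_ofNat] <;>
    grind

/-- u1, u2 solve the coupled NLS equation iff the zero-curvature equation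
holds for every spectral parameter and every point. -/
theorem stmt0 (u1 u2 : ℝ × ℝ → ℂ) (h1 : ContDiff ℝ (⊤ : ℕ∞) u1) (h2 : ContDiff ℝ (⊤ : ℕ∞) u2) :
    (∀ p : ℝ × ℝ, CNLSat u1 u2 p) ↔
      ∀ (l : ℂ) (p : ℝ × ℝ),
        (Matrix.of fun i j => pdt (fun q => Umat u1 u2 l q i j) p)
          - (Matrix.of fun i j => pdx (fun q => Vmat u1 u2 l q i j) p)
          + Umat u1 u2 l p * Vmat u1 u2 l p - Vmat u1 u2 l p * Umat u1 u2 l p = 0 := by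
  constructor
  · intro h l p
    obtain ⟨ha, hb⟩ := h p
    rw [curvature_eq u1 u2 h1 h2, ha, hb]
    ext i j
    fin_cases i <;> fin_cases j <;> simp
  · intro h p
    have e := h 0 p
    rw [curvature_eq u1 u2 h1 h2] at e
    have e1 := congrFun (congrFun e 0) 1
    have e2 := congrFun (congrFun e 0) 2
    simp only [Matrix.of_apply, Matrix.cons_val, Matrix.zero_apply] at e1 e2
    have hI : -I ≠ 0 := neg_ne_zero.mpr Complex.I_ne_zero
    exact ⟨(mul_eq_zero.mp e1).resolve_left hI, (mul_eq_zero.mp e2).resolve_left hI⟩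
end
end

section
/- Suppose u1, u2 : ℝ × ℝ → ℂ are smooth and solve the coupled NLS equation, λ ∈ ℂ, and Γ1, Γ2 : ℝ × ℝ → ℂ are differentiable and satisfy both the space Riccati equations and the time Riccati equations. Then at every (x,t): ∂t(u1·Γ1 + u2·Γ2) = ∂x(V11 + V12·Γ1 + V13·Γ2), i.e. u1Γ1 + u2Γ2 is a conserved density with flux V11 + V12Γ1 + V13Γ2. -/
open Complex MeasureTheory Filter Topology ComplexConjugate Matrix

noncomputable section

/-- Differentiable functions have the partial derivative `pdx`. -/
lemma hasDerivAt_pdx (f : ℝ × ℝ → ℂ) (hf : Differentiable ℝ f) (p : ℝ × ℝ) :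
    HasDerivAt (fun x => f (x, p.2)) (pdx f p) p.1 := by
  have h : DifferentiableAt ℝ (fun x : ℝ => f (x, p.2)) p.1 := by fun_prop
  exact h.hasDerivAt

lemma hasDerivAt_pdt (f : ℝ × ℝ → ℂ) (hf : Differentiable ℝ f) (p : ℝ × ℝ) :
    HasDerivAt (fun t => f (p.1, t)) (pdt f p) p.2 := by
  have h : DifferentiableAt ℝ (fun t : ℝ => f (p.1, t)) p.2 := by fun_prop
  exact h.hasDerivAt

lemma differentiable_pdx (f : ℝ × ℝ → ℂ) (hf : ContDiff ℝ (⊤ : ℕ∞) f) :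
    Differentiable ℝ (pdx f) := by
  have hd : Differentiable ℝ f := hf.differentiable (by simp)
  have h : pdx f = fun p => fderiv ℝ f p (1, 0) := by
    funext p
    have h1 : HasDerivAt (fun x : ℝ => (x, p.2)) ((1 : ℝ), (0 : ℝ)) p.1 :=
      (hasDerivAt_id p.1).prodMk (hasDerivAt_const p.1 p.2)
    have h2 : HasFDerivAt f (fderiv ℝ f p) (p.1, p.2) := (hd p).hasFDerivAt
    exact (h2.comp_hasDerivAt p.1 h1).deriv
  rw [h]
  have h3 : ContDiff ℝ 1 (fderiv ℝ f) := 
    ContDiff.fderiv_right (n := 2) (contDiff_infty.1 hf 2) (by norm_num)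
  have h4 : Differentiable ℝ (fderiv ℝ f) := h3.differentiable (by simp)
  exact h4.clm_apply (differentiable_const _)

/-- conservation equation for u1·Γ1 + u2·Γ2 with flux V11 + V12·Γ1 + V13·Γ2. -/
theorem stmt2 (u1 u2 : ℝ × ℝ → ℂ) (h1 : ContDiff ℝ (⊤ : ℕ∞) u1) (h2 : ContDiff ℝ (⊤ : ℕ∞) u2)
    (hnls : ∀ p : ℝ × ℝ, CNLSat u1 u2 p) (l : ℂ) (G1 G2 : ℝ × ℝ → ℂ)
    (hG1 : Differentiable ℝ G1) (hG2 : Differentiable ℝ G2)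
    (hric : ∀ p : ℝ × ℝ, SpaceRiccatiAt u1 u2 l G1 G2 p ∧ TimeRiccatiAt u1 u2 l G1 G2 p) :
    ∀ p : ℝ × ℝ,
      pdt (fun q => u1 q * G1 q + u2 q * G2 q) p
        = pdx (fun q => Vmat u1 u2 l q 0 0 + Vmat u1 u2 l q 0 1 * G1 q
            + Vmat u1 u2 l q 0 2 * G2 q) p := by
  intro p
  have d1 : Differentiable ℝ u1 := h1.differentiable (by simp)
  have d2 : Differentiable ℝ u2 := h2.differentiable (by simp)
  have c1 : Differentiable ℝ (fun q => conj (u1 q)) :=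
    Complex.conjCLE.differentiable.comp d1
  have c2 : Differentiable ℝ (fun q => conj (u2 q)) :=
    Complex.conjCLE.differentiable.comp d2
  obtain ⟨n1, n2⟩ := hnls p
  obtain ⟨⟨s1, s2⟩, ⟨t1, t2⟩⟩ := hric p
  have L := ((hasDerivAt_pdt u1 d1 p).mul (hasDerivAt_pdt G1 hG1 p)).add
    ((hasDerivAt_pdt u2 d2 p).mul (hasDerivAt_pdt G2 hG2 p))
  have X1 := hasDerivAt_pdx u1 d1 p
  have X2 := hasDerivAt_pdx u2 d2 p
  have Y1 := hasDerivAt_pdx _ (differentiable_pdx u1 h1) p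
  have Y2 := hasDerivAt_pdx _ (differentiable_pdx u2 h2) p
  have R := ((((X1.mul (hasDerivAt_pdx _ c1 p)).add
    (X2.mul (hasDerivAt_pdx _ c2 p))).const_mul I).const_add (-6*I*l^2)).add
      (((X1.const_mul (3*l)).add (Y1.const_mul I)).mul (hasDerivAt_pdx G1 hG1 p)) |>.add
      (((X2.const_mul (3*l)).add (Y2.const_mul I)).mul (hasDerivAt_pdx G2 hG2 p))
  have e1 : pdt (fun q => u1 q * G1 q + u2 q * G2 q) p = _ := L.deriv
  have e0 : (fun q => Vmat u1 u2 l q 0 0 + Vmat u1 u2 l q 0 1 * G1 q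
            + Vmat u1 u2 l q 0 2 * G2 q)
      = fun q => (-6*I*l^2 + I*(u1 q * conj (u1 q) + u2 q * conj (u2 q)))
        + (3*l*u1 q + I * pdx u1 q) * G1 q + (3*l*u2 q + I * pdx u2 q) * G2 q := by
    funext q
    simp [Vmat, nsq_eq]
  have e2 : pdx (fun q => (-6*I*l^2 + I*(u1 q * conj (u1 q) + u2 q * conj (u2 q)))
        + (3*l*u1 q + I * pdx u1 q) * G1 q + (3*l*u2 q + I * pdx u2 q) * G2 q) p = _ := R.deriv
  rw [e0, e1, e2, t1, t2, s1, s2]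
  simp only [nsq_eq] at n1 n2
  simp only [Vmat, nsq_eq, Matrix.of_apply, Matrix.cons_val', Matrix.cons_val_zero,
    Matrix.cons_val_one, Matrix.cons_val, Pi.add_apply, Pi.mul_apply]
  have m1 : pdt u1 p = I * (pdx (pdx u1) p
      + 2 * (u1 p * conj (u1 p) + u2 p * conj (u2 p)) * u1 p) := by
    linear_combination (-I) * n1 + pdt u1 p * Complex.I_mul_I
  have m2 : pdt u2 p = I * (pdx (pdx u2) p
      + 2 * (u1 p * conj (u1 p) + u2 p * conj (u2 p)) * u2 p) := by
    linear_combination (-I) * n2 + pdt u2 p * Complex.I_mul_I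
  rw [m1, m2]
  linear_combination (-3 * l * (pdx u1 p * G1 p + pdx u2 p * G2 p)) * Complex.I_mul_I
end
end

section
/- (Lemma 1, space part.) Let λ ∈ ℂ, let u1, u2, ũ1, ũ2 : ℝ × ℝ → ℂ, and let B_{jk} : ℝ × ℝ → ℂ (1 ≤ j,k ≤ 3) be differentiable functions whose first row satisfies ∂x B11 = u1·B21 + u2·B31 + conj(ũ1)·B12 + conj(ũ2)·B13, ∂x B12 = −3iλ·B12 + u1·B22 + u2·B32 − ũ1·B11, and ∂x B13 = −3iλ·B13 + u1·B23 + u2·B33 − ũ2·B11. Let Γ̃1, Γ̃2 : ℝ × ℝ → ℂ be differentiable and satisfy the space Riccati equations with fields ũ1, ũ2 and parameter λ. Set F_j := B_{j1} + B_{j2}·Γ̃1 + B_{j3}·Γ̃2 for j = 1,2,3. Then ∂x F1 = u1·F2 + u2·F3 − (ũ1·Γ̃1 + ũ2·Γ̃2)·F1; consequently, wherever F1 ≠ 0, u1·(F2/F1) + u2·(F3/F1) − ũ1·Γ̃1 − ũ2·Γ̃2 = (∂x F1)/F1. -/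
open Complex MeasureTheory Filter Topology ComplexConjugate Matrix

noncomputable section

/-- Lemma 1, space part. -/
theorem stmt3 (l : ℂ) (u1 u2 tu1 tu2 : ℝ × ℝ → ℂ)
    (B : Fin 3 → Fin 3 → ℝ × ℝ → ℂ) (hB : ∀ j k, Differentiable ℝ (B j k))
    (hrow1 : ∀ p : ℝ × ℝ,
      pdx (B 0 0) p = u1 p * B 1 0 p + u2 p * B 2 0 p
          + conj (tu1 p) * B 0 1 p + conj (tu2 p) * B 0 2 p ∧
      pdx (B 0 1) p = -3*I*l * B 0 1 p + u1 p * B 1 1 p + u2 p * B 2 1 p - tu1 p * B 0 0 p ∧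
      pdx (B 0 2) p = -3*I*l * B 0 2 p + u1 p * B 1 2 p + u2 p * B 2 2 p - tu2 p * B 0 0 p)
    (G1 G2 : ℝ × ℝ → ℂ) (hG1 : Differentiable ℝ G1) (hG2 : Differentiable ℝ G2)
    (hric : ∀ p : ℝ × ℝ, SpaceRiccatiAt tu1 tu2 l G1 G2 p)
    (F : Fin 3 → ℝ × ℝ → ℂ)
    (hF : ∀ j, F j = fun q => B j 0 q + B j 1 q * G1 q + B j 2 q * G2 q) :
    ∀ p : ℝ × ℝ,
      pdx (F 0) p = u1 p * F 1 p + u2 p * F 2 p - (tu1 p * G1 p + tu2 p * G2 p) * F 0 p ∧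
      (F 0 p ≠ 0 →
        u1 p * (F 1 p / F 0 p) + u2 p * (F 2 p / F 0 p) - tu1 p * G1 p - tu2 p * G2 p
          = pdx (F 0) p / F 0 p) := by
  intro p
  have hd : ∀ f : ℝ × ℝ → ℂ, Differentiable ℝ f →
      HasDerivAt (fun x => f (x, p.2)) (pdx f p) p.1 := by
    intro f hf
    have h : DifferentiableAt ℝ (fun x : ℝ => f (x, p.2)) p.1 := by fun_prop
    exact h.hasDerivAt
  obtain ⟨h0, h1, h2⟩ := hrow1 p
  obtain ⟨r1, r2⟩ := hric p
  have key : pdx (F 0) p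
      = u1 p * F 1 p + u2 p * F 2 p - (tu1 p * G1 p + tu2 p * G2 p) * F 0 p := by
    have hD := ((hd _ (hB 0 0)).add ((hd _ (hB 0 1)).mul (hd _ hG1))).add
      ((hd _ (hB 0 2)).mul (hd _ hG2))
    have hE : pdx (F 0) p = pdx (B 0 0) p + (pdx (B 0 1) p * G1 p + B 0 1 p * pdx G1 p)
        + (pdx (B 0 2) p * G2 p + B 0 2 p * pdx G2 p) := by
      rw [hF 0]
      exact hD.deriv
    rw [hE, h0, h1, h2, r1, r2, hF 0, hF 1, hF 2]
    ring
  refine ⟨key, fun hne => ?_⟩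
  rw [key]
  field_simp
  ring
end
end

section
/- (Lemma 1, time part.) Let λ ∈ ℂ, let u1, u2, ũ1, ũ2 : ℝ × ℝ → ℂ be differentiable, and write V = V(x,t,λ) (built from u1,u2) and Ṽ = Ṽ(x,t,λ) (built from ũ1,ũ2). Let B_{jk} : ℝ × ℝ → ℂ (1 ≤ j,k ≤ 3) be differentiable functions whose first row satisfies ∂t B_{1j} = Σ_k V_{1k}·B_{kj} − Σ_k B_{1k}·Ṽ_{kj} for j = 1,2,3. Let Γ̃1, Γ̃2 be differentiable and satisfy the time Riccati equations with matrix Ṽ. Set F_j := B_{j1} + B_{j2}·Γ̃1 + B_{j3}·Γ̃2 for j = 1,2,3. Then ∂t F1 = (V11·F1 + V12·F2 + V13·F3) − (Ṽ11 + Ṽ12·Γ̃1 + Ṽ13·Γ̃2)·F1; consequently, wherever F1 ≠ 0, (V11 + V12·(F2/F1) + V13·(F3/F1)) − (Ṽ11 + Ṽ12·Γ̃1 + Ṽ13·Γ̃2) = (∂t F1)/F1. -/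
open Complex MeasureTheory Filter Topology ComplexConjugate Matrix

noncomputable section

/-- Lemma 1, time part. -/
theorem stmt4 (l : ℂ) (u1 u2 tu1 tu2 : ℝ × ℝ → ℂ)
    (hu1 : Differentiable ℝ u1) (hu2 : Differentiable ℝ u2)
    (htu1 : Differentiable ℝ tu1) (htu2 : Differentiable ℝ tu2)
    (B : Fin 3 → Fin 3 → ℝ × ℝ → ℂ) (hB : ∀ j k, Differentiable ℝ (B j k))
    (hrow1 : ∀ (p : ℝ × ℝ) (j : Fin 3),
      pdt (B 0 j) p = (∑ k : Fin 3, Vmat u1 u2 l p 0 k * B k j p)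
        - ∑ k : Fin 3, B 0 k p * Vmat tu1 tu2 l p k j)
    (G1 G2 : ℝ × ℝ → ℂ) (hG1 : Differentiable ℝ G1) (hG2 : Differentiable ℝ G2)
    (hric : ∀ p : ℝ × ℝ, TimeRiccatiAt tu1 tu2 l G1 G2 p)
    (F : Fin 3 → ℝ × ℝ → ℂ)
    (hF : ∀ j, F j = fun q => B j 0 q + B j 1 q * G1 q + B j 2 q * G2 q) :
    ∀ p : ℝ × ℝ,
      pdt (F 0) p = (Vmat u1 u2 l p 0 0 * F 0 p + Vmat u1 u2 l p 0 1 * F 1 p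
          + Vmat u1 u2 l p 0 2 * F 2 p)
        - (Vmat tu1 tu2 l p 0 0 + Vmat tu1 tu2 l p 0 1 * G1 p
          + Vmat tu1 tu2 l p 0 2 * G2 p) * F 0 p ∧
      (F 0 p ≠ 0 →
        (Vmat u1 u2 l p 0 0 + Vmat u1 u2 l p 0 1 * (F 1 p / F 0 p)
            + Vmat u1 u2 l p 0 2 * (F 2 p / F 0 p))
          - (Vmat tu1 tu2 l p 0 0 + Vmat tu1 tu2 l p 0 1 * G1 p
            + Vmat tu1 tu2 l p 0 2 * G2 p)
          = pdt (F 0) p / F 0 p) := by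
  intro p
  have hd : ∀ f : ℝ × ℝ → ℂ, Differentiable ℝ f →
      HasDerivAt (fun t => f (p.1, t)) (pdt f p) p.2 := by
    intro f hf
    have h : DifferentiableAt ℝ (fun t : ℝ => f (p.1, t)) p.2 := by fun_prop
    exact h.hasDerivAt
  have key : pdt (F 0) p = pdt (B 0 0) p
      + (pdt (B 0 1) p * G1 p + B 0 1 p * pdt G1 p)
      + (pdt (B 0 2) p * G2 p + B 0 2 p * pdt G2 p) := by
    rw [hF 0]
    exact (((hd _ (hB 0 0)).add ((hd _ (hB 0 1)).mul (hd _ hG1))).add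
      ((hd _ (hB 0 2)).mul (hd _ hG2))).deriv
  have main : pdt (F 0) p = (Vmat u1 u2 l p 0 0 * F 0 p + Vmat u1 u2 l p 0 1 * F 1 p
          + Vmat u1 u2 l p 0 2 * F 2 p)
        - (Vmat tu1 tu2 l p 0 0 + Vmat tu1 tu2 l p 0 1 * G1 p
          + Vmat tu1 tu2 l p 0 2 * G2 p) * F 0 p := by
    rw [key, (hric p).1, (hric p).2, hrow1, hrow1, hrow1]
    simp only [hF, Fin.sum_univ_three]
    ring
  refine ⟨main, fun h0 => ?_⟩
  rw [main]
  generalize F 0 p = f at *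
  field_simp
end
end

section
/- Let a, b ∈ ℝ, let u1, u2, ũ1, ũ2 : ℝ × ℝ → ℂ be smooth, let Ω be as in the frozen BT matrix data, and set B(x,t,λ) := I₃ + λ⁻¹·B⁰(x,t). If for every λ ∈ ℂ \ {0} the gauge (Bäcklund) equations ∂x B = U(x,t,λ)·B − B·Ũ(x,t,λ) and ∂t B = V(x,t,λ)·B − B·Ṽ(x,t,λ) hold entrywise on ℝ × ℝ, then the fields u1, u2, ũ1, ũ2 satisfy the four BT equations. -/
open Complex MeasureTheory Filter Topology ComplexConjugate Matrix

noncomputable section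

theorem pdx_smul_aux (c : ℂ) (f : ℝ × ℝ → ℂ) (p : ℝ × ℝ) :
    pdx (fun q => c * f q) p = c * pdx f p := by
  unfold pdx; exact deriv_const_mul_field c

theorem pdt_smul_aux (c : ℂ) (f : ℝ × ℝ → ℂ) (p : ℝ × ℝ) :
    pdt (fun q => c * f q) p = c * pdt f p := by
  unfold pdt; exact deriv_const_mul_field c

theorem pdx_sub_aux (f g : ℝ × ℝ → ℂ) (hf : ContDiff ℝ (⊤ : ℕ∞) f)
    (hg : ContDiff ℝ (⊤ : ℕ∞) g) (p : ℝ × ℝ) :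
    pdx (fun q => f q - g q) p = pdx f p - pdx g p := by
  have hf' : Differentiable ℝ f := hf.differentiable (by simp)
  have hg' : Differentiable ℝ g := hg.differentiable (by simp)
  unfold pdx
  exact deriv_fun_sub (by fun_prop) (by fun_prop)

/-- the gauge (Bäcklund) equations for B = I + λ⁻¹B⁰ imply the four BT
equations for the fields. -/
theorem stmt7 (a b : ℝ) (u1 u2 tu1 tu2 : ℝ × ℝ → ℂ)
    (hu1 : ContDiff ℝ (⊤ : ℕ∞) u1) (hu2 : ContDiff ℝ (⊤ : ℕ∞) u2)
    (htu1 : ContDiff ℝ (⊤ : ℕ∞) tu1) (htu2 : ContDiff ℝ (⊤ : ℕ∞) tu2)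
    (Om : ℝ × ℝ → ℝ) (hOm : Differentiable ℝ Om)
    (hOm2 : ∀ p : ℝ × ℝ, (Om p)^2
      = 9*b^2 - Complex.normSq (u1 p - tu1 p) - Complex.normSq (u2 p - tu2 p))
    (hOm3b : ∀ p : ℝ × ℝ, Om p + 3*b ≠ 0)
    (Bf : ℂ → ℝ × ℝ → Matrix (Fin 3) (Fin 3) ℂ)
    (hBf : ∀ (l : ℂ) (q : ℝ × ℝ),
      Bf l q = 1 + l⁻¹ • frozenB0 a b (u1 q) (u2 q) (tu1 q) (tu2 q) (Om q))
    (hgauge : ∀ l : ℂ, l ≠ 0 → ∀ (p : ℝ × ℝ) (i j : Fin 3),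
      pdx (fun q => Bf l q i j) p
          = (Umat u1 u2 l p * Bf l p - Bf l p * Umat tu1 tu2 l p) i j ∧
      pdt (fun q => Bf l q i j) p
          = (Vmat u1 u2 l p * Bf l p - Bf l p * Vmat tu1 tu2 l p) i j) :
    ∀ p : ℝ × ℝ,
      BTspaceAt a u1 u2 tu1 tu2
        (frozenB0 a b (u1 p) (u2 p) (tu1 p) (tu2 p) (Om p)) (Om p) p ∧
      BTtimeAt a u1 u2 tu1 tu2
        (frozenB0 a b (u1 p) (u2 p) (tu1 p) (tu2 p) (Om p)) (Om p) p := by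
  intro p
  have hx := fun j => (hgauge 1 one_ne_zero p 0 j).1
  have ht := fun j => (hgauge 1 one_ne_zero p 0 j).2
  have e1 : (fun q => Bf 1 q 0 1) = fun q => (-(I/3)) * (u1 q - tu1 q) := by
    funext q; rw [hBf]; simp [frozenB0]; ring
  have e2 : (fun q => Bf 1 q 0 2) = fun q => (-(I/3)) * (u2 q - tu2 q) := by
    funext q; rw [hBf]; simp [frozenB0]; ring
  have hx1 := hx 1
  have hx2 := hx 2
  have ht1 := ht 1
  have ht2 := ht 2
  rw [e1, pdx_smul_aux] at hx1
  rw [e2, pdx_smul_aux] at hx2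
  rw [e1, pdt_smul_aux] at ht1
  rw [e2, pdt_smul_aux] at ht2
  have d1 := pdx_sub_aux u1 tu1 hu1 htu1 p
  have d2 := pdx_sub_aux u2 tu2 hu2 htu2 p
  have n1 : nsq (tu1 p) = tu1 p * conj (tu1 p) := (Complex.mul_conj _).symm
  have n2 : nsq (tu2 p) = tu2 p * conj (tu2 p) := (Complex.mul_conj _).symm
  rw [hBf] at hx1 hx2 ht1 ht2
  have b0 : frozenB0 a b (u1 p) (u2 p) (tu1 p) (tu2 p) (Om p) 0 0 = (a:ℂ) + I/3*(Om p:ℂ) := rfl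
  have b1 : frozenB0 a b (u1 p) (u2 p) (tu1 p) (tu2 p) (Om p) 0 1 = I/3*(tu1 p-u1 p) := rfl
  have b2 : frozenB0 a b (u1 p) (u2 p) (tu1 p) (tu2 p) (Om p) 0 2 = I/3*(tu2 p-u2 p) := rfl
  unfold BTspaceAt BTtimeAt
  generalize frozenB0 a b (u1 p) (u2 p) (tu1 p) (tu2 p) (Om p) = B at *
  have hI : I * I = -1 := Complex.I_mul_I
  simp [Umat, Vmat, Matrix.mul_apply, Fin.sum_univ_three, b0, b1, b2, n1, n2,
    Matrix.one_apply, Matrix.vecMul, dotProduct] at hx1 hx2 ht1 ht2 ⊢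
  have s1 : pdx (fun q => u1 q - tu1 q) p
      = tu1 p * ((Om p : ℂ) - 3*I*a) + 3*I*u1 p * B 1 1 + 3*I*u2 p * B 2 1 := by
    linear_combination (3*I) * hx1 + (pdx (fun q => u1 q - tu1 q) p - Om p * tu1 p + (u1 p - tu1 p) * 3 * I) * hI
  have s2 : pdx (fun q => u2 q - tu2 q) p
      = tu2 p * ((Om p : ℂ) - 3*I*a) + 3*I*u1 p * B 1 2 + 3*I*u2 p * B 2 2 := by
    linear_combination (3*I) * hx2 + (pdx (fun q => u2 q - tu2 q) p - Om p * tu2 p + (u2 p - tu2 p) * 3 * I) * hI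
  refine ⟨⟨s1, s2⟩, ?_, ?_⟩
  · rw [d1] at s1
    clear hx1 hx2 ht2
    clear hgauge hBf hx ht e1 e2 hOm2 hOm3b hOm hu1 hu2 htu1 htu2
    generalize pdt (fun q => u1 q - tu1 q) p = D at *
    grind
  · rw [d2] at s2
    clear hx1 hx2 ht1
    clear hgauge hBf hx ht e1 e2 hOm2 hOm3b hOm hu1 hu2 htu1 htu2
    generalize pdt (fun q => u2 q - tu2 q) p = D at *
    grind
end
end

section
/- (Lemma 3: the boundary equation implies conservation of the trace of the generalized monodromy matrix.) Fix λ ∈ ℂ and set V∞(λ) := diag(−6iλ², 3iλ², 3iλ²). Let p1,p2,q1,q2 : ℝ → ℂ be continuous boundary data and V₀(t,μ) the associated boundary V-matrix. Let M, N : ℝ → M₃(ℂ) be differentiable with N(t) invertible for every t, satisfying M'(t) = V∞(λ)·M(t) − M(t)·V₀(t,λ) and N'(t) = V∞(λ)·N(t) − N(t)·V₀(t,−λ), and let K : ℝ → M₃(ℂ) be differentiable with K'(t) = V₀(t,λ)·K(t) − K(t)·V₀(t,−λ). Then the function t ↦ trace(M(t)·K(t)·N(t)⁻¹) is constant. -/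
open Complex MeasureTheory Filter Topology ComplexConjugate Matrix

noncomputable section

section Helpers

attribute [local instance] Matrix.linftyOpNormedRing Matrix.linftyOpNormedAlgebra

/-- Entrywise differentiability of a matrix-valued function gives differentiability. -/
lemma hasDerivAt_matrix_aux (A : ℝ → Matrix (Fin 3) (Fin 3) ℂ) (A' : Matrix (Fin 3) (Fin 3) ℂ)
    (t : ℝ) (h : ∀ i j, HasDerivAt (fun s => A s i j) (A' i j) t) : HasDerivAt A A' t := by
  have h2 : HasDerivAt (fun s => ∑ i, ∑ j, A s i j • Matrix.single i j (1 : ℂ))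
      (∑ i, ∑ j, A' i j • Matrix.single i j (1 : ℂ)) t := by
    refine HasDerivAt.fun_sum fun i _ => HasDerivAt.fun_sum fun j _ => ?_
    exact (h i j).smul_const _
  have key : ∀ B : Matrix (Fin 3) (Fin 3) ℂ,
      ∑ i, ∑ j, B i j • Matrix.single i j (1 : ℂ) = B := by
    intro B
    conv_rhs => rw [Matrix.matrix_eq_sum_single B]
    simp [Matrix.smul_single]
  simpa only [key] using h2

/-- The trace of the generalized monodromy matrix has zero derivative. -/
lemma trace_conserved_aux (D : Matrix (Fin 3) (Fin 3) ℂ)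
    (V W M N K : ℝ → Matrix (Fin 3) (Fin 3) ℂ)
    (hNunit : ∀ t, IsUnit (N t))
    (hM : ∀ t i j, HasDerivAt (fun s => M s i j) ((D * M t - M t * V t) i j) t)
    (hN : ∀ t i j, HasDerivAt (fun s => N s i j) ((D * N t - N t * W t) i j) t)
    (hK : ∀ t i j, HasDerivAt (fun s => K s i j) ((V t * K t - K t * W t) i j) t) (t : ℝ) :
    HasDerivAt (fun s => (M s * K s * (N s)⁻¹).trace) 0 t := by
  have hM' := hasDerivAt_matrix_aux M _ t (hM t)
  have hN' := hasDerivAt_matrix_aux N _ t (hN t)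
  have hK' := hasDerivAt_matrix_aux K _ t (hK t)
  obtain ⟨u, hu⟩ := hNunit t
  have huinv : (N t)⁻¹ = ((u⁻¹ : (Matrix (Fin 3) (Fin 3) ℂ)ˣ) : Matrix (Fin 3) (Fin 3) ℂ) := by
    rw [← hu, Matrix.coe_units_inv]
  have hf : HasFDerivAt Ring.inverse _ (N t) := hu ▸ hasFDerivAt_ringInverse (𝕜 := ℝ) u
  have hNinv := hf.comp_hasDerivAt t hN'
  have hP := (hM'.mul hK').mul hNinv
  have htr := ((Matrix.traceLinearMap (Fin 3) ℝ ℂ).toContinuousLinearMap.hasFDerivAt).comp_hasDerivAt t hP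
  refine (htr.congr_deriv ?_).congr_of_eventuallyEq ?_
  · have h1 : (N t)⁻¹ * N t = 1 := by rw [huinv, ← hu]; simp
    have h2 : N t * (N t)⁻¹ = 1 := by rw [huinv, ← hu]; simp
    have alg : ((D * M t - M t * V t) * K t + M t * (V t * K t - K t * W t)) * (N t)⁻¹
        + M t * K t * -((N t)⁻¹ * (D * N t - N t * W t) * (N t)⁻¹)
        = D * (M t * K t * (N t)⁻¹) - (M t * K t * (N t)⁻¹) * D := by
      have e : (N t)⁻¹ * (D * N t - N t * W t) * (N t)⁻¹ = (N t)⁻¹ * D - W t * (N t)⁻¹ := by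
        calc _ = (N t)⁻¹ * D * (N t * (N t)⁻¹) - ((N t)⁻¹ * N t) * W t * (N t)⁻¹ := by
              noncomm_ring
          _ = _ := by rw [h1, h2]; simp
      rw [e]
      noncomm_ring
    have tr0 := congrArg Matrix.trace alg
    rw [Matrix.trace_sub, Matrix.trace_mul_comm D, sub_self] at tr0
    rw [← tr0]
    simp [← Matrix.nonsing_inv_eq_ringInverse, ← huinv]
    rw [← Matrix.trace_neg, ← Matrix.trace_add]
    rfl
  · refine Filter.Eventually.of_forall fun s => ?_
    simp [Matrix.nonsing_inv_eq_ringInverse]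

end Helpers

/-- Lemma 3, the boundary equation implies conservation of the trace of the
generalized monodromy matrix. -/
theorem stmt11 (l : ℂ) (p1 p2 q1 q2 : ℝ → ℂ)
    (hp1 : Continuous p1) (hp2 : Continuous p2) (hq1 : Continuous q1) (hq2 : Continuous q2)
    (M N K : ℝ → Matrix (Fin 3) (Fin 3) ℂ)
    (hNunit : ∀ t, IsUnit (N t))
    (hM : ∀ (t : ℝ) (i j : Fin 3), HasDerivAt (fun s => M s i j)
      (((Matrix.diagonal ![-6*I*l^2, 3*I*l^2, 3*I*l^2] : Matrix (Fin 3) (Fin 3) ℂ) * M t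
        - M t * V0mat p1 p2 q1 q2 t l) i j) t)
    (hN : ∀ (t : ℝ) (i j : Fin 3), HasDerivAt (fun s => N s i j)
      (((Matrix.diagonal ![-6*I*l^2, 3*I*l^2, 3*I*l^2] : Matrix (Fin 3) (Fin 3) ℂ) * N t
        - N t * V0mat p1 p2 q1 q2 t (-l)) i j) t)
    (hK : ∀ (t : ℝ) (i j : Fin 3), HasDerivAt (fun s => K s i j)
      ((V0mat p1 p2 q1 q2 t l * K t - K t * V0mat p1 p2 q1 q2 t (-l)) i j) t) :
    ∀ t s : ℝ, (M t * K t * (N t)⁻¹).trace = (M s * K s * (N s)⁻¹).trace := by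
  intro t s
  have h := trace_conserved_aux _ (fun t => V0mat p1 p2 q1 q2 t l)
    (fun t => V0mat p1 p2 q1 q2 t (-l)) M N K hNunit hM hN hK
  exact is_const_of_deriv_eq_zero (fun t => (h t).differentiableAt) (fun t => (h t).deriv) t s
end
end

section
/- Let b ∈ ℝ. Let p1, p2, q1, q2 : ℝ → ℂ be differentiable (interpreted as u_j(0,t) and ∂x u_j(0,t)) and let Ω̂ : ℝ → ℝ be differentiable with Ω̂² = 9b² − 4(|p1|²+|p2|²), Ω̂(t) ≠ 0 and Ω̂(t)+3b ≠ 0 for all t. Assume the new boundary conditions hold for all t: i·p1' + 2·p1·(|p1|²+|p2|²) + q1·Ω̂ + 2·(q1·|p2|² − q2·p1·conj(p2))/(Ω̂+3b) = 0 and i·p2' + 2·p2·(|p1|²+|p2|²) + q2·Ω̂ + 2·(q2·|p1|² − q1·conj(p1)·p2)/(Ω̂+3b) = 0. Define K⁰(t) := [[(i/3)Ω̂, −(2i/3)p1, −(2i/3)p2], [−(2i/3)conj(p1), −ib + 4i|p1|²/(3(Ω̂+3b)), 4i·conj(p1)·p2/(3(Ω̂+3b))], [−(2i/3)conj(p2),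 4i·p1·conj(p2)/(3(Ω̂+3b)), −ib + 4i|p2|²/(3(Ω̂+3b))]] and K(t,λ) := I₃ + λ⁻¹·K⁰(t). Then for every λ ∈ ℂ \ {0} and every t, ∂t K(t,λ) = V₀(t,λ)·K(t,λ) − K(t,λ)·V₀(t,−λ). -/
open Complex MeasureTheory Filter Topology ComplexConjugate Matrix

noncomputable section

theorem alg (O b w p1 p2 c1 c2 a1 a2 r1 r2 d1 d2 k1 k2 : ℂ) (hD : O + 3*b ≠ 0) (hO : O ≠ 0)
    (hOt : O^2 = 9*b^2 - 4*(p1*c1+p2*c2))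
    (h1 : I * d1 + 2 * p1 * (p1*c1+p2*c2) + a1 * O + 2*(a1*(p2*c2) - a2*p1*c2)/(O+3*b) = 0)
    (h2 : I * d2 + 2 * p2 * (p1*c1+p2*c2) + a2 * O + 2*(a2*(p1*c1) - a1*c1*p2)/(O+3*b) = 0)
    (h3 : -I * k1 + 2 * c1 * (c1*p1+c2*p2) + r1 * O + 2*(r1*(c2*p2) - r2*c1*p2)/(O+3*b) = 0)
    (h4 : -I * k2 + 2 * c2 * (c1*p1+c2*p2) + r2 * O + 2*(r2*(c1*p1) - r1*p1*c2)/(O+3*b) = 0)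
    (hw : O * w = -2 * (d1*c1 + p1*k1 + (d2*c2+p2*k2))) :
    ∃ D : ℂ, D ≠ 0 ∧ O + 3*b = D ∧ O = D/2 - 2*(p1*c1+p2*c2)/D ∧
     b = (D/2 + 2*(p1*c1+p2*c2)/D)/3 ∧
     (d1 = I*(2 * p1 * (p1*c1+p2*c2) + a1 * O + 2*(a1*(p2*c2) - a2*p1*c2)/D) ∧
      d2 = I*(2 * p2 * (p1*c1+p2*c2) + a2 * O + 2*(a2*(p1*c1) - a1*c1*p2)/D) ∧
      k1 = -I*(2 * c1 * (c1*p1+c2*p2) + r1 * O + 2*(r1*(c2*p2) - r2*c1*p2)/D) ∧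
      k2 = -I*(2 * c2 * (c1*p1+c2*p2) + r2 * O + 2*(r2*(c1*p1) - r1*p1*c2)/D)) ∧
     w = -2*I*(a1*c1+a2*c2-p1*r1-p2*r2) := by
  have hI : I * I = -1 := Complex.I_mul_I
  obtain ⟨D, hDD⟩ : ∃ D, O + 3*b = D := ⟨_, rfl⟩
  rw [hDD] at h1 h2 h3 h4 hD
  have hb : b = (D - O)/3 := by rw [← hDD]; ring
  have hOO : O = D/2 - 2*(p1*c1+p2*c2)/D := by
    rw [hb] at hOt
    field_simp
    linear_combination hOt
  have hd : (d1 = I*(2 * p1 * (p1*c1+p2*c2) + a1 * O + 2*(a1*(p2*c2) - a2*p1*c2)/D) ∧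
      d2 = I*(2 * p2 * (p1*c1+p2*c2) + a2 * O + 2*(a2*(p1*c1) - a1*c1*p2)/D) ∧
      k1 = -I*(2 * c1 * (c1*p1+c2*p2) + r1 * O + 2*(r1*(c2*p2) - r2*c1*p2)/D) ∧
      k2 = -I*(2 * c2 * (c1*p1+c2*p2) + r2 * O + 2*(r2*(c1*p1) - r1*p1*c2)/D)) := by
    refine ⟨?_, ?_, ?_, ?_⟩
    · linear_combination -I * h1 + d1 * hI
    · linear_combination -I * h2 + d2 * hI
    · linear_combination I * h3 + k1 * hI
    · linear_combination I * h4 + k2 * hI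
  refine ⟨D, hD, hDD, hOO, ?_, hd, ?_⟩
  · rw [hb]; nth_rewrite 1 [hOO]; ring
  · apply mul_left_cancel₀ hO
    obtain ⟨e1, e2, e3, e4⟩ := hd
    rw [hw, e1, e2, e3, e4]
    ring

/-- the dynamical K matrix for the new time-dependent boundary condition
satisfies the boundary equation. -/
theorem stmt13 (b : ℝ) (p1 p2 q1 q2 : ℝ → ℂ)
    (hp1 : Differentiable ℝ p1) (hp2 : Differentiable ℝ p2)
    (hq1 : Differentiable ℝ q1) (hq2 : Differentiable ℝ q2)
    (Om : ℝ → ℝ) (hOm : Differentiable ℝ Om)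
    (hOm2 : ∀ t, (Om t)^2 = 9*b^2 - 4*(Complex.normSq (p1 t) + Complex.normSq (p2 t)))
    (hOmne : ∀ t, Om t ≠ 0) (hOm3b : ∀ t, Om t + 3*b ≠ 0)
    (hbc1 : ∀ t, I * deriv p1 t + 2 * p1 t * (nsq (p1 t) + nsq (p2 t)) + q1 t * (Om t : ℂ)
      + 2*(q1 t * nsq (p2 t) - q2 t * p1 t * conj (p2 t)) / ((Om t : ℂ) + 3*b) = 0)
    (hbc2 : ∀ t, I * deriv p2 t + 2 * p2 t * (nsq (p1 t) + nsq (p2 t)) + q2 t * (Om t : ℂ)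
      + 2*(q2 t * nsq (p1 t) - q1 t * conj (p1 t) * p2 t) / ((Om t : ℂ) + 3*b) = 0)
    (K0 : ℝ → Matrix (Fin 3) (Fin 3) ℂ)
    (hK0 : ∀ t, K0 t =
      !![I/3*(Om t : ℂ), -(2*I/3)*p1 t, -(2*I/3)*p2 t;
         -(2*I/3)*conj (p1 t), -I*b + 4*I*nsq (p1 t)/(3*((Om t : ℂ) + 3*b)),
           4*I*conj (p1 t)*p2 t/(3*((Om t : ℂ) + 3*b));
         -(2*I/3)*conj (p2 t), 4*I*p1 t*conj (p2 t)/(3*((Om t : ℂ) + 3*b)),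
           -I*b + 4*I*nsq (p2 t)/(3*((Om t : ℂ) + 3*b))])
    (Kf : ℂ → ℝ → Matrix (Fin 3) (Fin 3) ℂ)
    (hKf : ∀ (l : ℂ) (t : ℝ), Kf l t = 1 + l⁻¹ • K0 t) :
    ∀ l : ℂ, l ≠ 0 → ∀ (t : ℝ) (i j : Fin 3),
      HasDerivAt (fun s => Kf l s i j)
        ((V0mat p1 p2 q1 q2 t l * Kf l t - Kf l t * V0mat p1 p2 q1 q2 t (-l)) i j) t := by
  intro l hl t
  have hn : ∀ z : ℂ, nsq z = z * conj z := fun z => by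
    unfold nsq; rw [Complex.mul_conj]
  have hd1 : HasDerivAt p1 (deriv p1 t) t := (hp1 t).hasDerivAt
  have hd2 : HasDerivAt p2 (deriv p2 t) t := (hp2 t).hasDerivAt
  have hc1 : HasDerivAt (fun s => conj (p1 s)) (conj (deriv p1 t)) t := hd1.star
  have hc2 : HasDerivAt (fun s => conj (p2 s)) (conj (deriv p2 t)) t := hd2.star
  have hO : HasDerivAt (fun s => (Om s : ℂ)) ((deriv Om t : ℝ) : ℂ) t :=
    ((hOm t).hasDerivAt).ofReal_comp
  have hb1 := hbc1 t
  have hb2 := hbc2 t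
  have hb1' := congrArg conj hb1
  have hb2' := congrArg conj hb2
  simp only [hn, map_add, map_mul, map_sub, map_div₀, Complex.conj_conj, Complex.conj_ofReal,
    Complex.conj_I, map_zero, map_ofNat] at hb1 hb2 hb1' hb2'
  have hOc : ∀ s, (Om s : ℂ)^2 = 9*(b:ℂ)^2 - 4*(p1 s * conj (p1 s) + p2 s * conj (p2 s)) := by
    intro s
    rw [Complex.mul_conj, Complex.mul_conj]
    exact_mod_cast hOm2 s
  have hDne : (Om t : ℂ) + 3*b ≠ 0 := by exact_mod_cast hOm3b t
  have hOne : (Om t : ℂ) ≠ 0 := by exact_mod_cast hOmne t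
  have hw0 : (Om t : ℂ) * ((deriv Om t : ℝ) : ℂ) =
      -2 * (deriv p1 t * conj (p1 t) + p1 t * conj (deriv p1 t)
        + (deriv p2 t * conj (p2 t) + p2 t * conj (deriv p2 t))) := by
    have h1 := hO.fun_pow 2
    have h2 := (((hd1.mul hc1).add (hd2.mul hc2)).const_mul 4).const_sub (9*(b:ℂ)^2)
    have h3 := h1.unique (h2.congr_of_eventuallyEq (Eventually.of_forall hOc))
    norm_num at h3
    linear_combination h3 / 2
  have hDd := hO.add_const (3*(b:ℂ))
  have hD3 := hDd.const_mul 3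
  have hD3ne : 3*((Om t : ℂ) + 3*b) ≠ 0 := mul_ne_zero (by norm_num) hDne
  have e11 := (((hd1.fun_mul hc1).const_mul (4*I)).fun_div hD3 hD3ne).const_add (-I*(b:ℂ))
  have e22 := (((hd2.fun_mul hc2).const_mul (4*I)).fun_div hD3 hD3ne).const_add (-I*(b:ℂ))
  have e12 := ((hc1.const_mul (4*I)).fun_mul hd2).fun_div hD3 hD3ne
  have e21 := ((hd1.const_mul (4*I)).fun_mul hc2).fun_div hD3 hD3ne
  have e00 := hO.const_mul (I/3)
  have e01 := hd1.const_mul (-(2*I/3))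
  have e02 := hd2.const_mul (-(2*I/3))
  have e10 := hc1.const_mul (-(2*I/3))
  have e20 := hc2.const_mul (-(2*I/3))
  have hOt := hOc t
  intro i j
  have hfun : (fun s => Kf l s i j) = fun s => (1 : Matrix (Fin 3) (Fin 3) ℂ) i j + l⁻¹ *
    K0 s i j := by
    funext s; rw [hKf]; simp
  rw [hfun, hKf l t]
  have hcomb : ∀ f : ℝ → ℂ, ∀ f' g : ℂ, ∀ c : ℂ, HasDerivAt f f' t → g = l⁻¹ * f' →
      HasDerivAt (fun s => c + l⁻¹ * f s) g t := by
    intro f f' g c h e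
    rw [e]
    exact (h.const_mul _).const_add c
  have hI : I * I = -1 := Complex.I_mul_I
  simp only [hK0, V0mat, hn]
  generalize ((deriv Om t : ℝ) : ℂ) = w at *
  generalize deriv p1 t = d1 at *
  generalize deriv p2 t = d2 at *
  generalize conj d1 = k1 at *
  generalize conj d2 = k2 at *
  generalize conj (q1 t) = r1 at *
  generalize conj (q2 t) = r2 at *
  generalize q1 t = a1 at *
  generalize q2 t = a2 at *
  obtain ⟨D, hD, hDD, hOO, hbb, ⟨HD1, HD2, hk1, hk2⟩, hw⟩ := alg (Om t) b w (p1 t) (p2 t) (conj (p1 t)) (conj (p2 t))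
    a1 a2 r1 r2 d1 d2 k1 k2 hDne hOne hOt hb1 hb2 hb1' hb2' hw0
  have hI3 : Complex.I^3 = -Complex.I := by rw [pow_succ, Complex.I_sq]; ring
  fin_cases i <;> fin_cases j
  · refine hcomb _ _ _ _ e00 ?_
    simp only [Matrix.sub_apply, Matrix.mul_apply, Fin.sum_univ_three, Matrix.add_apply, Matrix.smul_apply, smul_eq_mul]
    simp [Matrix.one_apply]
    clear * - hl hD hDD hOO hbb hw HD1 HD2 hk1 hk2 hI3
    try simp only [hDD]
    try simp only [hw]
    try simp only [HD1, HD2, hk1, hk2]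
    try simp only [hbb]
    try simp only [hOO]
    field_simp
    ring_nf
    try simp only [Complex.I_sq, hI3, Complex.I_pow_four]
    try ring_nf
  · refine hcomb _ _ _ _ e01 ?_
    simp only [Matrix.sub_apply, Matrix.mul_apply, Fin.sum_univ_three, Matrix.add_apply, Matrix.smul_apply, smul_eq_mul]
    simp [Matrix.one_apply]
    clear * - hl hD hDD hOO hbb hw HD1 HD2 hk1 hk2 hI3
    try simp only [hDD]
    try simp only [hw]
    try simp only [HD1, HD2, hk1, hk2]
    try simp only [hbb]
    try simp only [hOO]
    field_simp
    ring_nf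
    try simp only [Complex.I_sq, hI3, Complex.I_pow_four]
    try ring_nf
  · refine hcomb _ _ _ _ e02 ?_
    simp only [Matrix.sub_apply, Matrix.mul_apply, Fin.sum_univ_three, Matrix.add_apply, Matrix.smul_apply, smul_eq_mul]
    simp [Matrix.one_apply]
    clear * - hl hD hDD hOO hbb hw HD1 HD2 hk1 hk2 hI3
    try simp only [hDD]
    try simp only [hw]
    try simp only [HD1, HD2, hk1, hk2]
    try simp only [hbb]
    try simp only [hOO]
    field_simp
    ring_nf
    try simp only [Complex.I_sq, hI3, Complex.I_pow_four]
    try ring_nf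
  · refine hcomb _ _ _ _ e10 ?_
    simp only [Matrix.sub_apply, Matrix.mul_apply, Fin.sum_univ_three, Matrix.add_apply, Matrix.smul_apply, smul_eq_mul]
    simp [Matrix.one_apply]
    clear * - hl hD hDD hOO hbb hw HD1 HD2 hk1 hk2 hI3
    try simp only [hDD]
    try simp only [hw]
    try simp only [HD1, HD2, hk1, hk2]
    try simp only [hbb]
    try simp only [hOO]
    field_simp
    ring_nf
    try simp only [Complex.I_sq, hI3, Complex.I_pow_four]
    try ring_nf
  · refine hcomb _ _ _ _ e11 ?_
    simp only [Matrix.sub_apply, Matrix.mul_apply, Fin.sum_univ_three, Matrix.add_apply, Matrix.smul_apply, smul_eq_mul]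
    simp [Matrix.one_apply]
    clear * - hl hD hDD hOO hbb hw HD1 HD2 hk1 hk2 hI3
    try simp only [hDD]
    try simp only [hw]
    try simp only [HD1, HD2, hk1, hk2]
    try simp only [hbb]
    try simp only [hOO]
    field_simp
    ring_nf
    try simp only [Complex.I_sq, hI3, Complex.I_pow_four]
    try ring_nf
  · refine hcomb _ _ _ _ e12 ?_
    simp only [Matrix.sub_apply, Matrix.mul_apply, Fin.sum_univ_three, Matrix.add_apply, Matrix.smul_apply, smul_eq_mul]
    simp [Matrix.one_apply]
    clear * - hl hD hDD hOO hbb hw HD1 HD2 hk1 hk2 hI3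
    try simp only [hDD]
    try simp only [hw]
    try simp only [HD1, HD2, hk1, hk2]
    try simp only [hbb]
    try simp only [hOO]
    field_simp
    ring_nf
    try simp only [Complex.I_sq, hI3, Complex.I_pow_four]
    try ring_nf
  · refine hcomb _ _ _ _ e20 ?_
    simp only [Matrix.sub_apply, Matrix.mul_apply, Fin.sum_univ_three, Matrix.add_apply, Matrix.smul_apply, smul_eq_mul]
    simp [Matrix.one_apply]
    clear * - hl hD hDD hOO hbb hw HD1 HD2 hk1 hk2 hI3
    try simp only [hDD]
    try simp only [hw]
    try simp only [HD1, HD2, hk1, hk2]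
    try simp only [hbb]
    try simp only [hOO]
    field_simp
    ring_nf
    try simp only [Complex.I_sq, hI3, Complex.I_pow_four]
    try ring_nf
  · refine hcomb _ _ _ _ e21 ?_
    simp only [Matrix.sub_apply, Matrix.mul_apply, Fin.sum_univ_three, Matrix.add_apply, Matrix.smul_apply, smul_eq_mul]
    simp [Matrix.one_apply]
    clear * - hl hD hDD hOO hbb hw HD1 HD2 hk1 hk2 hI3
    try simp only [hDD]
    try simp only [hw]
    try simp only [HD1, HD2, hk1, hk2]
    try simp only [hbb]
    try simp only [hOO]
    field_simp
    ring_nf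
    try simp only [Complex.I_sq, hI3, Complex.I_pow_four]
    try ring_nf
  · refine hcomb _ _ _ _ e22 ?_
    simp only [Matrix.sub_apply, Matrix.mul_apply, Fin.sum_univ_three, Matrix.add_apply, Matrix.smul_apply, smul_eq_mul]
    simp [Matrix.one_apply]
    clear * - hl hD hDD hOO hbb hw HD1 HD2 hk1 hk2 hI3
    try simp only [hDD]
    try simp only [hw]
    try simp only [HD1, HD2, hk1, hk2]
    try simp only [hbb]
    try simp only [hOO]
    field_simp
    ring_nf
    try simp only [Complex.I_sq, hI3, Complex.I_pow_four]
    try ring_nf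
end
end

section
/- Let a, b ∈ ℝ, u1, u2 ∈ ℂ, and Ω ∈ ℝ with Ω² = 9b² − |u1|² − |u2|² and Ω + 3b ≠ 0. For c ∈ ℝ let M(c) be the 3×3 complex matrix [[c + (i/3)Ω, −(i/3)u1, −(i/3)u2], [−(i/3)conj(u1), c − ib + (i/3)|u1|²/(Ω+3b), (i/3)conj(u1)·u2/(Ω+3b)], [−(i/3)conj(u2), (i/3)u1·conj(u2)/(Ω+3b), c − ib + (i/3)|u2|²/(Ω+3b)]]. Then M(a)·M(−a) = −(a²+b²)·I₃ and M(a) + M(−a) = (2i/3)·N, where N := [[Ω, −u1, −u2], [−conj(u1), −3b + |u1|²/(Ω+3b), conj(u1)·u2/(Ω+3b)], [−conj(u2), u1·conj(u2)/(Ω+3b), −3b + |u2|²/(Ω+3b)]]. Consequently, for every λ ∈ ℂ \ {0}: (I₃ + λ⁻¹·M(a))·(I₃ + λ⁻¹·M(−a)) = (1 − (a²+b²)·λ⁻²)·I₃ + (2i/(3λ))·N. (This is the composition of two Bäcklund matrices, frozen at the boundary under the Dirichlet condition on the intermediate field and the odd reduction, yielding the dressed boundary matrix.) -/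
open Complex MeasureTheory Filter Topology ComplexConjugate Matrix

noncomputable section

/-- The dressed matrix squares to a scalar. -/
lemma N_sq_aux (b O u1 u2 v1 v2 : ℂ) (h : O^2 = 9*b^2 - u1*v1 - u2*v2) (hD : O + 3*b ≠ 0)
    (N : Matrix (Fin 3) (Fin 3) ℂ)
    (hN : N = !![O, -u1, -u2;
                 -v1, -3*b + u1*v1/(O+3*b), v1*u2/(O+3*b);
                 -v2, u1*v2/(O+3*b), -3*b + u2*v2/(O+3*b)]) :
    N * N = (9*b^2) • (1 : Matrix (Fin 3) (Fin 3) ℂ) := by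
  obtain ⟨D, rfl⟩ : ∃ D, O = D - 3*b := ⟨O + 3*b, by ring⟩
  have e : D - 3*b + 3*b = D := by ring
  rw [e] at hD hN
  subst hN
  ext i j
  fin_cases i <;> fin_cases j <;>
    simp [Matrix.mul_apply, Fin.sum_univ_three] <;> field_simp
  · linear_combination h
  · linear_combination -u1 * h
  · linear_combination -u2 * h
  · linear_combination -v1 * h
  · linear_combination u1 * v1 * h
  · linear_combination v1 * u2 * h
  · linear_combination -v2 * h
  · linear_combination u1 * v2 * h
  · linear_combination u2 * v2 * h

/-- composition of two frozen Bäcklund matrices yields the dressed boundary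
matrix. -/
theorem stmt14 (a b : ℝ) (u1 u2 : ℂ) (Om : ℝ)
    (hOm2 : Om^2 = 9*b^2 - Complex.normSq u1 - Complex.normSq u2)
    (hOm3b : Om + 3*b ≠ 0)
    (Mm : ℝ → Matrix (Fin 3) (Fin 3) ℂ)
    (hM : ∀ c : ℝ, Mm c =
      !![(c:ℂ) + I/3*(Om:ℂ), -(I/3)*u1, -(I/3)*u2;
         -(I/3)*conj u1, (c:ℂ) - I*b + (I/3)*nsq u1/((Om:ℂ)+3*b),
           (I/3)*conj u1*u2/((Om:ℂ)+3*b);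
         -(I/3)*conj u2, (I/3)*u1*conj u2/((Om:ℂ)+3*b),
           (c:ℂ) - I*b + (I/3)*nsq u2/((Om:ℂ)+3*b)])
    (N : Matrix (Fin 3) (Fin 3) ℂ)
    (hN : N = !![(Om:ℂ), -u1, -u2;
                 -conj u1, -3*(b:ℂ) + nsq u1/((Om:ℂ)+3*b), conj u1*u2/((Om:ℂ)+3*b);
                 -conj u2, u1*conj u2/((Om:ℂ)+3*b), -3*(b:ℂ) + nsq u2/((Om:ℂ)+3*b)]) :
    Mm a * Mm (-a) = (-((a:ℂ)^2+(b:ℂ)^2)) • (1 : Matrix (Fin 3) (Fin 3) ℂ) ∧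
    Mm a + Mm (-a) = (2*I/3) • N ∧
    ∀ l : ℂ, l ≠ 0 →
      (1 + l⁻¹ • Mm a) * (1 + l⁻¹ • Mm (-a))
        = (1 - ((a:ℂ)^2+(b:ℂ)^2) * (l⁻¹)^2) • (1 : Matrix (Fin 3) (Fin 3) ℂ)
          + (2*I/(3*l)) • N := by
  have h1 : nsq u1 = u1 * conj u1 := (Complex.mul_conj u1).symm
  have h2 : nsq u2 = u2 * conj u2 := (Complex.mul_conj u2).symm
  have hO : (Om:ℂ)^2 = 9*(b:ℂ)^2 - u1 * conj u1 - u2 * conj u2 := by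
    rw [Complex.mul_conj, Complex.mul_conj]
    exact_mod_cast hOm2
  have hD : (Om:ℂ) + 3*b ≠ 0 := by exact_mod_cast hOm3b
  have hNN : N * N = (9*(b:ℂ)^2) • (1 : Matrix (Fin 3) (Fin 3) ℂ) :=
    N_sq_aux b Om u1 u2 (conj u1) (conj u2) hO hD N (by rw [hN, h1, h2])
  have hMN : ∀ c : ℝ, Mm c = (c:ℂ) • (1 : Matrix (Fin 3) (Fin 3) ℂ) + (I/3) • N := by
    intro c
    rw [hM, hN]
    ext i j
    fin_cases i <;> fin_cases j <;> simp <;> ring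
  have hI : I * I = -1 := Complex.I_mul_I
  have hprod : Mm a * Mm (-a) = (-((a:ℂ)^2+(b:ℂ)^2)) • (1 : Matrix (Fin 3) (Fin 3) ℂ) := by
    rw [hMN, hMN]
    simp only [Matrix.add_mul, Matrix.mul_add, Matrix.smul_mul, Matrix.mul_smul, hNN,
      Matrix.one_mul, Matrix.mul_one, Complex.ofReal_neg]
    match_scalars
    · linear_combination (b:ℂ)^2 * hI
    · ring
  have hsum : Mm a + Mm (-a) = (2*I/3) • N := by
    rw [hMN, hMN, Complex.ofReal_neg]
    module
  refine ⟨hprod, hsum, ?_⟩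
  intro l hl
  have e : (1 + l⁻¹ • Mm a) * (1 + l⁻¹ • Mm (-a))
      = 1 + l⁻¹ • (Mm a + Mm (-a)) + (l⁻¹)^2 • (Mm a * Mm (-a)) := by
    simp only [Matrix.add_mul, Matrix.mul_add, Matrix.smul_mul, Matrix.mul_smul,
      Matrix.one_mul, Matrix.mul_one]
    module
  rw [e, hprod, hsum]
  match_scalars
  · ring
  · field_simp
end
end
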